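/- Fix ε > 0 sufficiently small and γ ∈ (0,1), and set γ' := ε²/(3(1+γ)) and C := 3(γ')^{-3/2}. Let α ∈ (0,1) and let d be sufficiently large (as a function of ε, γ, α), let n ∈ ℕ, and let q ≥ s satisfy d ≥ q, q = 4(1+γ+ε)d / log(d^α/√k) for some 1 ≤ k ≤ d^{2αγ}, and s ≥ d^α + C√(log n). Let ℋ = (L,H) be a correspondence cover of an n-vertex graph G with |L(v)| = q for each v ∈ V(G) and Δ(H) ≤ d. Independently for each vertex v, sample a uniformly random subset S(v) ⊆ L(v) of size s, let S := ∪_{v ∈ V(G)} S(v), and define S'(v) := {c ∈ S(v) : |N_H(c) ∩ S| ≤ (1+γ')sd/q}. Then Pr[there exists v ∈ V(G) with |S'(v)| < (1−γ')s] ≤ 1/n. -/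

import Mathlib

open Finset

attribute [local instance] Classical.propDecidable

noncomputable section

/-- `(L, H)` is a correspondence cover of `G`. -/
structure IsCorrespondenceCover {V C : Type} (G : SimpleGraph V) (H : SimpleGraph C)
    (L : V → Finset C) : Prop where
  partition : ∀ c : C, ∃! v : V, c ∈ L v
  indep : ∀ v : V, ∀ c ∈ L v, ∀ c' ∈ L v, ¬H.Adj c c'
  matching : ∀ u v : V, ∀ c ∈ L u, ∀ c₁ ∈ L v, ∀ c₂ ∈ L v,
    H.Adj c c₁ → H.Adj c c₂ → c₁ = c₂
  not_adj : ∀ u v : V, ¬G.Adj u v → ∀ c ∈ L u, ∀ c' ∈ L v, ¬H.Adj c c'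

theorem aux_choose (q s : ℕ) (hq : 0 < q) (hs : s ≤ q) (j : ℕ) (hj : j ≤ s) :
    ((q - j).choose (s - j) : ℝ) ≤ ((s : ℝ) / q) ^ j * (q.choose s : ℝ) := by
  induction j with
  | zero => simp
  | succ j ih =>
    have ih := ih (by omega)
    obtain ⟨a, rfl⟩ : ∃ a, s = a + j + 1 := ⟨s - j - 1, by omega⟩
    obtain ⟨b, rfl⟩ : ∃ b, q = b + j + 1 := ⟨q - j - 1, by omega⟩
    have e1 : b + j + 1 - j = b + 1 := by omega
    have e2 : a + j + 1 - j = a + 1 := by omega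
    have e3 : b + j + 1 - (j + 1) = b := by omega
    have e4 : a + j + 1 - (j + 1) = a := by omega
    rw [e1, e2] at ih
    rw [e3, e4]
    have h1 := Nat.add_one_mul_choose_eq b a
    have h1' : ((b : ℝ) + 1) * (b.choose a) = ((b + 1).choose (a + 1)) * ((a : ℝ) + 1) := by
      exact_mod_cast h1
    have hab : (a : ℝ) ≤ b := by exact_mod_cast (by omega : a ≤ b)
    have h2 : (b.choose a : ℝ) = ((a : ℝ) + 1) / (b + 1) * ((b + 1).choose (a + 1)) := by
      field_simp; linarith
    have h3 : ((a : ℝ) + 1) / (b + 1) ≤ ((a + j + 1 : ℕ) : ℝ) / ((b + j + 1 : ℕ) : ℝ) := by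
      push_cast
      rw [div_le_div_iff₀ (by positivity) (by positivity)]
      nlinarith [(Nat.cast_nonneg j : (0 : ℝ) ≤ j)]
    rw [h2, pow_succ]
    calc _ ≤ ((a + j + 1 : ℕ) : ℝ) / ((b + j + 1 : ℕ) : ℝ) *
          ((((a + j + 1 : ℕ) : ℝ) / ((b + j + 1 : ℕ) : ℝ)) ^ j * ((b + j + 1).choose (a + j + 1))) := by
          gcongr
      _ = _ := by ring

theorem aux_count {C : Type} (L J : Finset C) (q s : ℕ) (hL : L.card = q) (hq : 0 < q)
    (hs : s ≤ q) (hJ : J ⊆ L) :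
    (((L.powersetCard s).filter fun S => J ⊆ S).card : ℝ)
      ≤ ((s : ℝ) / q) ^ J.card * (q.choose s : ℝ) := by
  by_cases hj : J.card ≤ s
  · refine le_trans ?_ (aux_choose q s hq hs J.card hj)
    have : ((L.powersetCard s).filter fun S => J ⊆ S).card
        ≤ ((L \ J).powersetCard (s - J.card)).card := by
      apply Finset.card_le_card_of_injOn (fun S => S \ J)
      · intro S hS
        simp only [Finset.coe_filter, Finset.mem_powersetCard, Set.mem_ofPred_eq] at hS
        simp only [Finset.mem_coe, Finset.mem_powersetCard]
        refine ⟨Finset.sdiff_subset_sdiff hS.1.1 le_rfl, ?_⟩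
        rw [Finset.card_sdiff_of_subset hS.2, hS.1.2]
      · intro S hS S' hS' h
        simp only [Finset.coe_filter, Finset.mem_powersetCard, Set.mem_ofPred_eq] at hS hS'
        rw [← Finset.sdiff_union_of_subset hS.2, ← Finset.sdiff_union_of_subset hS'.2]
        simp only at h
        rw [h]
    rw [Finset.card_powersetCard, Finset.card_sdiff_of_subset hJ, hL] at this
    exact_mod_cast this
  · have : ((L.powersetCard s).filter fun S => J ⊆ S) = ∅ := by
      apply Finset.filter_eq_empty_iff.2
      intro S hS hJS
      have := Finset.card_le_card hJS
      rw [(Finset.mem_powersetCard.1 hS).2] at this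
      omega
    rw [this]
    simp only [Finset.card_empty, Nat.cast_zero]
    positivity

theorem aux_powerset_sum {C : Type} (A : Finset C) (y : ℝ) :
    ∑ J ∈ A.powerset, y ^ J.card = (1 + y) ^ A.card := by
  have := Finset.sum_pow_mul_eq_add_pow y 1 A
  simp only [one_pow, mul_one] at this
  rw [this, add_comm]

theorem aux_hyper {C : Type} (L T : Finset C) (q s : ℕ) (hL : L.card = q) (hq : 0 < q)
    (hs : s ≤ q) (y : ℝ) (hy : 0 ≤ y) :
    ∑ S ∈ L.powersetCard s, (1 + y) ^ (T ∩ S).card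
      ≤ ((L.powersetCard s).card : ℝ) * Real.exp (y * (s / q) * (T ∩ L).card) := by
  calc ∑ S ∈ L.powersetCard s, (1 + y) ^ (T ∩ S).card
      = ∑ S ∈ L.powersetCard s, ∑ J ∈ (T ∩ S).powerset, y ^ J.card := by
        simp only [aux_powerset_sum]
    _ = ∑ J ∈ (T ∩ L).powerset, ∑ S ∈ (L.powersetCard s).filter (fun S => J ⊆ S), y ^ J.card := by
        apply Finset.sum_comm'
        intro S J
        simp only [Finset.mem_powerset, Finset.mem_filter, Finset.mem_powersetCard,
          Finset.subset_inter_iff]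
        constructor
        · rintro ⟨⟨a, b⟩, c, e⟩
          exact ⟨⟨⟨a, b⟩, e⟩, c, e.trans a⟩
        · rintro ⟨⟨⟨a, b⟩, e⟩, c, f⟩
          exact ⟨⟨a, b⟩, c, e⟩
    _ ≤ ∑ J ∈ (T ∩ L).powerset, (q.choose s : ℝ) * (y * (s / q)) ^ J.card := by
        apply Finset.sum_le_sum
        intro J hJ
        rw [Finset.sum_const, nsmul_eq_mul, mul_pow]
        have h := aux_count L J q s hL hq hs
          ((Finset.mem_powerset.1 hJ).trans Finset.inter_subset_right)
        have : 0 ≤ y ^ J.card := by positivity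
        nlinarith
    _ = (q.choose s : ℝ) * (1 + y * (s / q)) ^ (T ∩ L).card := by
        rw [← Finset.mul_sum, aux_powerset_sum]
    _ ≤ _ := by
        rw [Finset.card_powersetCard, hL]
        gcongr
        rw [mul_comm _ ((T ∩ L).card : ℝ), Real.exp_nat_mul]
        gcongr
        rw [add_comm]
        exact Real.add_one_le_exp _

/-- Chernoff bound for a fixed set of colors, in counting form. -/
theorem aux_prod {V C : Type} [Fintype V] [Fintype C] (H : SimpleGraph C)
    (L : V → Finset C) (q s d : ℕ) (hq : 0 < q) (hs : s ≤ q) (hL : ∀ v, (L v).card = q)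
    (hpart : ∀ c : C, ∃! v : V, c ∈ L v)
    (v : V) (B T : Finset C)
    (hT : T.card ≤ B.card * d) (hTv : Disjoint T (L v)) (y : ℝ) (hy : 0 ≤ y) :
    ∑ σ ∈ (Finset.univ.pi fun v : V => (L v).powersetCard s).filter
        (fun σ => B ⊆ σ v (Finset.mem_univ v)),
      (1 + y) ^ (∑ u : V, (T ∩ σ u (Finset.mem_univ u)).card)
    ≤ (((Finset.univ.pi fun v : V => (L v).powersetCard s).filter
        (fun σ => B ⊆ σ v (Finset.mem_univ v))).card : ℝ)
       * Real.exp (y * (B.card * (s * d / q))) := by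
  have hΩ : (Finset.univ.pi fun v : V => (L v).powersetCard s).filter
        (fun σ => B ⊆ σ v (Finset.mem_univ v))
      = Finset.univ.pi fun u : V => ((L u).powersetCard s).filter (fun S => u = v → B ⊆ S) := by
    ext σ
    simp only [Finset.mem_filter, Finset.mem_pi]
    constructor
    · rintro ⟨h1, h2⟩ u hu
      refine ⟨h1 u hu, ?_⟩
      rintro rfl
      exact h2
    · intro h
      exact ⟨fun u hu => (h u hu).1, (h v (Finset.mem_univ v)).2 rfl⟩
  rw [hΩ]
  have h1 := Finset.prod_sum (R := ℝ) (Finset.univ : Finset V)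
    (fun u : V => ((L u).powersetCard s).filter (fun S => u = v → B ⊆ S))
    (fun u S => (1 + y) ^ (T ∩ S).card)
  have h2 : ∀ σ : (a : V) → a ∈ (Finset.univ : Finset V) → Finset C,
      (1 + y) ^ (∑ u : V, (T ∩ σ u (Finset.mem_univ u)).card)
      = ∏ x ∈ (Finset.univ : Finset V).attach, (1 + y) ^ (T ∩ σ x.1 x.2).card := by
    intro σ
    rw [Finset.prod_pow_eq_pow_sum,
      ← Finset.sum_attach (Finset.univ) (fun u => (T ∩ σ u (Finset.mem_univ u)).card)]
  simp only [h2]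
  refine (le_of_eq ?_).trans ((le_of_eq h1.symm).trans ?_)
  · congr!
  rw [Finset.card_pi]
  push_cast
  have h3 : ∑ u : V, ((T ∩ L u).card : ℝ) ≤ B.card * d := by
    have : ∑ u : V, (T ∩ L u).card = T.card := by
      rw [← Finset.card_biUnion]
      · congr 1
        ext c
        obtain ⟨u, hu, -⟩ := hpart c
        simp only [Finset.mem_biUnion, Finset.mem_univ, true_and, Finset.mem_inter]
        exact ⟨fun ⟨_, h, _⟩ => h, fun h => ⟨u, h, hu⟩⟩
      · intro a _ b _ hab
        refine Finset.disjoint_left.2 ?_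
        intro c hc hc'
        exact hab ((hpart c).unique (Finset.mem_inter.1 hc).2 (Finset.mem_inter.1 hc').2)
    have h4 : ∑ u : V, (T ∩ L u).card ≤ B.card * d := this ▸ hT
    exact_mod_cast h4
  calc _ ≤ ∏ u : V, ((((L u).powersetCard s).filter (fun S => u = v → B ⊆ S)).card : ℝ)
        * Real.exp (y * (s / q) * (T ∩ L u).card) := by
        apply Finset.prod_le_prod
        · intro u _
          exact Finset.sum_nonneg fun S _ => by positivity
        · intro u _
          by_cases huv : u = v
          · subst huv
            rw [Finset.disjoint_iff_inter_eq_empty.1 hTv]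
            simp only [Finset.card_empty, Nat.cast_zero, mul_zero, Real.exp_zero, mul_one]
            rw [Finset.cast_card]
            apply Finset.sum_le_sum
            intro S hS
            have hSL := (Finset.mem_powersetCard.1 (Finset.mem_filter.1 hS).1).1
            rw [Finset.disjoint_iff_inter_eq_empty.1 (hTv.mono_right hSL)]
            simp
          · have : ((L u).powersetCard s).filter (fun S => u = v → B ⊆ S)
                = (L u).powersetCard s := by
              apply Finset.filter_true_of_mem
              intro S _ h
              exact absurd h huv
            rw [this]
            exact aux_hyper (L u) T q s (hL u) hq hs y hy
    _ = (∏ u : V, ((((L u).powersetCard s).filter (fun S => u = v → B ⊆ S)).card : ℝ))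
        * Real.exp (y * (s / q) * ∑ u : V, ((T ∩ L u).card : ℝ)) := by
        rw [Finset.prod_mul_distrib, ← Real.exp_sum, Finset.mul_sum]
    _ ≤ _ := by
        refine mul_le_mul (le_of_eq (by congr!)) (Real.exp_le_exp.2 ?_) (Real.exp_pos _).le
          (by positivity)
        · calc _ ≤ y * (s / q) * (B.card * d) := by gcongr
            _ = _ := by ring

theorem aux_vertex {V C : Type} [Fintype V] [Fintype C] (G : SimpleGraph V) (H : SimpleGraph C)
    (L : V → Finset C) (q s d : ℕ) (hq : 0 < q) (hs : s ≤ q) (hqd : q ≤ d)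
    (hL : ∀ v, (L v).card = q) (hc : IsCorrespondenceCover G H L)
    (hd : ∀ c : C, H.degree c ≤ d) (v : V) (δ : ℝ) (hδ : 0 < δ) (hδ1 : δ ≤ 1) :
    (((Finset.univ.pi fun v : V => (L v).powersetCard s).filter fun σ =>
                (((σ v (Finset.mem_univ v)).filter fun c =>
                      ((H.neighborFinset c ∩
                          (Finset.univ.biUnion fun u : V => σ u (Finset.mem_univ u))).card : ℝ)
                        ≤ (1 + δ) * s * d / q).card : ℝ)
                  < (1 - δ) * s).card : ℝ)
    ≤ ((Finset.univ.pi fun v : V => (L v).powersetCard s).card : ℝ) *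
      (2 ^ s * Real.exp (- (δ ^ 3 * s ^ 2 / 3))) := by
  set Ω := (Finset.univ.pi fun v : V => (L v).powersetCard s) with hΩ
  set M : ℝ := s * d / q with hM
  have hsM : (s : ℝ) ≤ M := by
    rw [hM, le_div_iff₀ (by positivity)]
    gcongr
  have hδlog : δ ^ 2 / 3 + δ ≤ (1 + δ) * Real.log (1 + δ) := by
    have h := Real.le_log_one_add_of_nonneg hδ.le
    have : (1 + δ) * (2 * δ / (δ + 2)) - δ = δ ^ 2 / (δ + 2) := by field_simp; ring
    have h2 : δ ^ 2 / 3 ≤ δ ^ 2 / (δ + 2) := by gcongr; linarith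
    nlinarith
  let N : Finset C → Finset C := fun B => B.biUnion fun c => H.neighborFinset c
  let F : ((a : V) → a ∈ (Finset.univ : Finset V) → Finset C) → Finset C → ℝ := fun σ B =>
    (1 + δ) ^ (∑ u : V, (N B ∩ σ u (Finset.mem_univ u)).card) *
      Real.exp (- (Real.log (1 + δ) * (B.card * ((1 + δ) * M))))
  let Q : Finset (Finset C) := (L v).powerset.filter fun B => δ * s ≤ (B.card : ℝ)
  have hFpos : ∀ σ B, 0 ≤ F σ B := fun σ B => by
    simp only [F]; positivity
  have key1 : ∀ σ ∈ Ω, (((σ v (Finset.mem_univ v)).filter fun c =>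
                      ((H.neighborFinset c ∩
                          (Finset.univ.biUnion fun u : V => σ u (Finset.mem_univ u))).card : ℝ)
                        ≤ (1 + δ) * s * d / q).card : ℝ)
                  < (1 - δ) * s →
      1 ≤ ∑ B ∈ Q.filter (fun B => B ⊆ σ v (Finset.mem_univ v)), F σ B := by
    intro σ hσ hbad
    have hσv := Finset.mem_powersetCard.1 (Finset.mem_pi.1 hσ v (Finset.mem_univ v))
    set B := (σ v (Finset.mem_univ v)).filter fun c =>
                      ¬ ((H.neighborFinset c ∩
                          (Finset.univ.biUnion fun u : V => σ u (Finset.mem_univ u))).card : ℝ)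
                        ≤ (1 + δ) * s * d / q with hB
    have hcard := Finset.card_filter_add_card_filter_not (s := σ v (Finset.mem_univ v))
      (fun c => ((H.neighborFinset c ∩
                          (Finset.univ.biUnion fun u : V => σ u (Finset.mem_univ u))).card : ℝ)
                        ≤ (1 + δ) * s * d / q)
    rw [hσv.2] at hcard
    have hcard' := congrArg (fun n : ℕ => (n : ℝ)) hcard
    simp only [Nat.cast_add] at hcard'
    have hBs : B ⊆ σ v (Finset.mem_univ v) := Finset.filter_subset _ _
    have hBL : B ⊆ L v := hBs.trans hσv.1
    have hBcard : δ * s ≤ (B.card : ℝ) := by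
      linarith
    have hBQ : B ∈ Q.filter (fun B => B ⊆ σ v (Finset.mem_univ v)) := by
      simp only [Q, Finset.mem_filter, Finset.mem_powerset]
      exact ⟨⟨hBL, hBcard⟩, hBs⟩
    refine le_trans ?_ (Finset.single_le_sum (fun B _ => hFpos σ B) hBQ)
    have hsum1 : (B.card : ℝ) * ((1 + δ) * M) ≤ ∑ c ∈ B, ((H.neighborFinset c ∩
        (Finset.univ.biUnion fun u : V => σ u (Finset.mem_univ u))).card : ℝ) := by
      rw [← nsmul_eq_mul]
      apply Finset.card_nsmul_le_sum
      intro c hcB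
      have := (Finset.mem_filter.1 hcB).2
      push Not at this
      have e : (1 + δ) * M = (1 + δ) * s * d / q := by rw [hM]; ring
      rw [e]; exact this.le
    have hsum2 : ∑ c ∈ B, (H.neighborFinset c ∩
        (Finset.univ.biUnion fun u : V => σ u (Finset.mem_univ u))).card
        ≤ ∑ u : V, (N B ∩ σ u (Finset.mem_univ u)).card := by
      rw [← Finset.card_biUnion]
      · refine le_trans (Finset.card_le_card ?_) Finset.card_biUnion_le
        intro x
        simp only [N, Finset.mem_biUnion, Finset.mem_inter, Finset.mem_univ, true_and]
        rintro ⟨c, hcB, hx, u, hu⟩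
        exact ⟨u, ⟨c, hcB, hx⟩, hu⟩
      · intro a ha b hb hab
        refine Finset.disjoint_left.2 ?_
        intro x hx hx'
        obtain ⟨u, hu, -⟩ := hc.partition x
        have h1 := (H.mem_neighborFinset _ _).1 (Finset.mem_inter.1 hx).1
        have h2 := (H.mem_neighborFinset _ _).1 (Finset.mem_inter.1 hx').1
        exact hab (hc.matching u v x hu a (hBL ha) b (hBL hb) h1.symm h2.symm)
    have hsum3 : (B.card : ℝ) * ((1 + δ) * M) ≤
        ((∑ u : V, (N B ∩ σ u (Finset.mem_univ u)).card : ℕ) : ℝ) :=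
      hsum1.trans (by exact_mod_cast hsum2)
    simp only [F]
    rw [← Real.exp_log (show 0 < 1 + δ by linarith), ← Real.exp_nat_mul,
      Real.exp_log (show 0 < 1 + δ by linarith), ← Real.exp_add]
    apply Real.one_le_exp
    have hlog : 0 ≤ Real.log (1 + δ) := Real.log_nonneg (by linarith)
    nlinarith
  have key2 : ∀ B ∈ Q, ∑ σ ∈ Ω.filter (fun σ => B ⊆ σ v (Finset.mem_univ v)), F σ B
      ≤ ((Ω.filter (fun σ => B ⊆ σ v (Finset.mem_univ v))).card : ℝ)
        * Real.exp (- (δ ^ 3 * s ^ 2 / 3)) := by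
    intro B hB
    simp only [Q, Finset.mem_filter, Finset.mem_powerset] at hB
    have hT : (N B).card ≤ B.card * d := by
      refine Finset.card_biUnion_le.trans ?_
      rw [← smul_eq_mul]
      apply Finset.sum_le_card_nsmul
      intro c _
      rw [SimpleGraph.card_neighborFinset_eq_degree]
      exact hd c
    have hTv : Disjoint (N B) (L v) := by
      rw [Finset.disjoint_left]
      intro x hx hx'
      simp only [N, Finset.mem_biUnion, SimpleGraph.mem_neighborFinset] at hx
      obtain ⟨c, hcB, hcx⟩ := hx
      exact hc.indep v c (hB.1 hcB) x hx' hcx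
    have h := aux_prod H L q s d hq hs hL hc.partition v B (N B) hT hTv δ hδ.le
    simp only [F]
    rw [← Finset.sum_mul]
    refine (mul_le_mul_of_nonneg_right h (Real.exp_pos _).le).trans ?_
    rw [mul_assoc, ← Real.exp_add]
    apply mul_le_mul_of_nonneg_left _ (Nat.cast_nonneg _)
    apply Real.exp_le_exp.2
    have hs0 : (0 : ℝ) ≤ s := Nat.cast_nonneg _
    have hBM : δ * s ^ 2 ≤ B.card * M := by
      calc δ * s ^ 2 = (δ * s) * s := by ring
        _ ≤ _ := by
          gcongr
          exact hB.2
    have hBM0 : 0 ≤ B.card * M := le_trans (by positivity) hBM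
    have e1 := mul_le_mul_of_nonneg_right hδlog hBM0
    have e2 := mul_le_mul_of_nonneg_left hBM (show 0 ≤ δ ^ 2 / 3 by positivity)
    rw [← hM]
    nlinarith
  have key3 : ∑ B ∈ Q, ((Ω.filter (fun σ => B ⊆ σ v (Finset.mem_univ v))).card : ℝ)
      ≤ Ω.card * 2 ^ s := by
    have : ∑ B ∈ Q, (Ω.filter (fun σ => B ⊆ σ v (Finset.mem_univ v))).card
      ≤ Ω.card * 2 ^ s := by
      have := Finset.sum_card_bipartiteAbove_eq_sum_card_bipartiteBelow (s := Q) (t := Ω)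
        (fun B σ => B ⊆ σ v (Finset.mem_univ v))
      simp only [Finset.bipartiteAbove, Finset.bipartiteBelow] at this
      rw [this, ← smul_eq_mul]
      apply Finset.sum_le_card_nsmul
      intro σ hσ
      have hσv := Finset.mem_powersetCard.1 (Finset.mem_pi.1 hσ v (Finset.mem_univ v))
      calc _ ≤ ((σ v (Finset.mem_univ v)).powerset).card := by
            apply Finset.card_le_card
            intro B hB
            exact Finset.mem_powerset.2 (Finset.mem_filter.1 hB).2
        _ = _ := by rw [Finset.card_powerset, hσv.2]
    exact_mod_cast this
  rw [Finset.cast_card]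
  calc _ ≤ ∑ σ ∈ Ω, ∑ B ∈ Q.filter (fun B => B ⊆ σ v (Finset.mem_univ v)), F σ B := by
        rw [Finset.sum_filter]
        apply Finset.sum_le_sum
        intro σ hσ
        split_ifs with h
        · exact key1 σ hσ h
        · exact Finset.sum_nonneg fun B _ => hFpos σ B
    _ = ∑ B ∈ Q, ∑ σ ∈ Ω.filter (fun σ => B ⊆ σ v (Finset.mem_univ v)), F σ B := by
        apply Finset.sum_comm'
        intro σ B
        simp only [Finset.mem_filter]
        tauto
    _ ≤ ∑ B ∈ Q, ((Ω.filter (fun σ => B ⊆ σ v (Finset.mem_univ v))).card : ℝ)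
        * Real.exp (- (δ ^ 3 * s ^ 2 / 3)) := Finset.sum_le_sum key2
    _ ≤ _ := by
        rw [← Finset.sum_mul, ← mul_assoc]
        gcongr

/-- With high probability, after removing from each sampled list `S(v)` the colors `c` whose
neighborhood in `H` meets the union `S` of all sampled lists in more than `(1+γ')sd/q`
colors, all the lists `S'(v)` still have at least `(1-γ')s` colors.  Probabilities are
expressed by counting outcomes of the uniform product sample space
`Ω = Π_v {S ⊆ L(v) : |S| = s}`. -/
theorem stmt8 (γ : ℝ) (hγ : γ ∈ Set.Ioo (0 : ℝ) 1) :
    ∃ ε₀ : ℝ, 0 < ε₀ ∧ ∀ ε : ℝ, 0 < ε → ε ≤ ε₀ →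
    ∀ α : ℝ, α ∈ Set.Ioo (0 : ℝ) 1 →
    ∃ d₀ : ℕ, ∀ d : ℕ, d₀ ≤ d → ∀ (n : ℕ) (k : ℝ) (q s : ℕ),
      1 ≤ k → k ≤ (d : ℝ) ^ (2 * α * γ) →
      (q : ℝ) = 4 * (1 + γ + ε) * d / Real.log ((d : ℝ) ^ α / Real.sqrt k) →
      s ≤ q → q ≤ d →
      (d : ℝ) ^ α + (3 * (ε ^ 2 / (3 * (1 + γ))) ^ (-(3 : ℝ) / 2)) * Real.sqrt (Real.log n)
          ≤ (s : ℝ) →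
      ∀ (V C : Type) [Fintype V] [Fintype C] (G : SimpleGraph V) (H : SimpleGraph C)
        (L : V → Finset C),
        IsCorrespondenceCover G H L →
        Fintype.card V = n →
        (∀ v : V, (L v).card = q) →
        (∀ c : C, H.degree c ≤ d) →
        (((Finset.univ.pi fun v : V => (L v).powersetCard s).filter fun σ =>
              ∃ v : V,
                (((σ v (Finset.mem_univ v)).filter fun c =>
                      ((H.neighborFinset c ∩
                          (Finset.univ.biUnion fun u : V => σ u (Finset.mem_univ u))).card : ℝ)
                        ≤ (1 + ε ^ 2 / (3 * (1 + γ))) * s * d / q).card : ℝ)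
                  < (1 - ε ^ 2 / (3 * (1 + γ))) * s).card : ℝ)
          ≤ (1 / (n : ℝ)) *
            ((Finset.univ.pi fun v : V => (L v).powersetCard s).card : ℝ) := by
  obtain ⟨hγ0, hγ1⟩ := hγ
  refine ⟨1, one_pos, ?_⟩
  intro ε hε hε1 α hα
  obtain ⟨hα0, hα1⟩ := hα
  have hδ : 0 < ε ^ 2 / (3 * (1 + γ)) := by positivity
  have hδ1 : ε ^ 2 / (3 * (1 + γ)) ≤ 1 := by
    rw [div_le_one (by positivity)]
    nlinarith
  generalize ε ^ 2 / (3 * (1 + γ)) = δ at hδ hδ1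
  have htend := (tendsto_rpow_atTop hα0).comp (tendsto_natCast_atTop_atTop (R := ℝ))
  obtain ⟨d₀, hd₀⟩ := Filter.eventually_atTop.1 (htend.eventually_ge_atTop (9 / δ ^ 3))
  refine ⟨d₀, ?_⟩
  intro d hd n k q s _ _ _ hsq hqd hs V C _ _ G H L hc hn hL hdeg
  have hda : 9 / δ ^ 3 ≤ (d : ℝ) ^ α := hd₀ d hd
  rcases Nat.eq_zero_or_pos n with h0 | hnpos
  · have : IsEmpty V := Fintype.card_eq_zero_iff.1 (hn.trans h0)
    simp
  have hn0 : (0 : ℝ) < n := by exact_mod_cast hnpos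
  have hlogn : 0 ≤ Real.log n := Real.log_nonneg (by exact_mod_cast hnpos)
  have hC : 0 ≤ 3 * δ ^ (-(3 : ℝ) / 2) * Real.sqrt (Real.log n) := by positivity
  have h9 : 0 < 9 / δ ^ 3 := by positivity
  have hs1 : 9 / δ ^ 3 ≤ s := by linarith
  have hs2 : 3 * δ ^ (-(3 : ℝ) / 2) * Real.sqrt (Real.log n) ≤ s := by linarith
  have hspos : (0 : ℝ) < s := by linarith
  have hs0 : 0 < s := by exact_mod_cast hspos
  have hpow : (δ ^ (-(3 : ℝ) / 2)) ^ 2 = (δ ^ 3)⁻¹ := by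
    rw [← Real.rpow_natCast, ← Real.rpow_mul hδ.le, ← Real.rpow_natCast, ← Real.rpow_neg hδ.le]
    norm_num
  have hsq2 : 9 * (δ ^ 3)⁻¹ * Real.log n ≤ (s : ℝ) ^ 2 := by
    have := pow_le_pow_left₀ hC hs2 2
    rw [mul_pow, mul_pow, hpow, Real.sq_sqrt hlogn] at this
    linarith
  have hδ3 : 0 < δ ^ 3 := by positivity
  have hA : 9 * Real.log n ≤ δ ^ 3 * s ^ 2 := by
    have := mul_le_mul_of_nonneg_left hsq2 hδ3.le
    have e : δ ^ 3 * (9 * (δ ^ 3)⁻¹ * Real.log n) = 9 * Real.log n := by field_simp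
    linarith
  have hB : 9 * (s : ℝ) ≤ δ ^ 3 * s ^ 2 := by
    have h1 : 9 ≤ s * δ ^ 3 := (div_le_iff₀ hδ3).1 hs1
    nlinarith
  have hexp : (2 : ℝ) ^ s * Real.exp (- (δ ^ 3 * s ^ 2 / 3)) ≤ 1 / (n : ℝ) ^ 2 := by
    have h2 : (2 : ℝ) ^ s ≤ Real.exp s := by
      rw [← mul_one (s : ℝ), Real.exp_nat_mul]
      gcongr
      linarith [Real.add_one_le_exp (1 : ℝ)]
    have h3 : 1 / (n : ℝ) ^ 2 = Real.exp (-(2 * Real.log n)) := by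
      rw [Real.exp_neg, one_div]
      congr 1
      have := Real.exp_nat_mul (Real.log n) 2
      rw [Real.exp_log hn0] at this
      exact_mod_cast this.symm
    rw [h3]
    calc _ ≤ Real.exp s * Real.exp (- (δ ^ 3 * s ^ 2 / 3)) := by gcongr
      _ = Real.exp (s + - (δ ^ 3 * s ^ 2 / 3)) := by rw [Real.exp_add]
      _ ≤ _ := by
        apply Real.exp_le_exp.2
        linarith
  have hv := fun v => aux_vertex G H L q s d (hs0.trans_le hsq) hsq hqd hL hc hdeg v δ hδ hδ1
  set Ω := (Finset.univ.pi fun v : V => (L v).powersetCard s) with hΩ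
  have hsub := Finset.card_le_card (show (Ω.filter fun σ =>
              ∃ v : V,
                (((σ v (Finset.mem_univ v)).filter fun c =>
                      ((H.neighborFinset c ∩
                          (Finset.univ.biUnion fun u : V => σ u (Finset.mem_univ u))).card : ℝ)
                        ≤ (1 + δ) * s * d / q).card : ℝ)
                  < (1 - δ) * s) ⊆ Finset.univ.biUnion (fun v : V => Ω.filter fun σ =>
                (((σ v (Finset.mem_univ v)).filter fun c =>
                      ((H.neighborFinset c ∩
                          (Finset.univ.biUnion fun u : V => σ u (Finset.mem_univ u))).card : ℝ)
                        ≤ (1 + δ) * s * d / q).card : ℝ)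
                  < (1 - δ) * s) by
      intro σ hσ
      obtain ⟨h1, v, h2⟩ := Finset.mem_filter.1 hσ
      exact Finset.mem_biUnion.2 ⟨v, Finset.mem_univ v, Finset.mem_filter.2 ⟨h1, h2⟩⟩)
  have hle := (Nat.cast_le (α := ℝ)).2 (hsub.trans Finset.card_biUnion_le)
  refine hle.trans ?_
  push_cast
  refine (Finset.sum_le_sum fun v _ => (hv v).trans
    (mul_le_mul_of_nonneg_left hexp (Nat.cast_nonneg _))).trans ?_
  rw [Finset.sum_const, Finset.card_univ, hn, nsmul_eq_mul]
  apply le_of_eq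
  field_simp
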